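/- arXiv:1304.4948 — 3 statements merged into one kernel-verified Lean document; each statement's English description precedes it below -/
import Mathlib

section
/- Let B be a real number with B ≥ 1 and let V be a natural number with V ≤ B. Then B·(1 − (1 − 1/B)^V) ≥ (1 − 1/e)·V. -/
/-- For a real `B ≥ 1` and a natural number `V` with `V ≤ B`,
`B·(1 - (1 - 1/B)^V) ≥ (1 - 1/e)·V`. -/
theorem expected_coverage_bound (B : ℝ) (hB : 1 ≤ B) (V : ℕ) (hV : (V : ℝ) ≤ B) :
    (1 - 1 / Real.exp 1) * (V : ℝ) ≤ B * (1 - (1 - 1 / B) ^ V) := by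
  have hB0 : 0 < B := by linarith
  have h0 : 0 ≤ 1 - 1 / B := by
    rw [sub_nonneg, div_le_one hB0]; exact hB
  have h1 : (1 - 1 / B) ^ V ≤ Real.exp (-((V : ℝ) / B)) := by
    calc (1 - 1 / B) ^ V ≤ (Real.exp (-(1 / B))) ^ V :=
          pow_le_pow_left₀ h0 (Real.one_sub_le_exp_neg _) V
      _ = Real.exp (-((V : ℝ) / B)) := by
          rw [← Real.exp_nat_mul]; congr 1; ring
  obtain ⟨x, hx⟩ : ∃ x : ℝ, x = (V : ℝ) / B := ⟨_, rfl⟩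
  have hx0 : 0 ≤ x := by rw [hx]; positivity
  have hx1 : x ≤ 1 := by rw [hx, div_le_one hB0]; exact hV
  have hVx : (V : ℝ) = B * x := by rw [hx]; field_simp
  have h2 := convexOn_exp.2 (Set.mem_univ (0 : ℝ)) (Set.mem_univ (-1 : ℝ))
    (sub_nonneg.2 hx1) hx0 (by ring)
  simp only [smul_eq_mul, mul_zero, zero_add, Real.exp_zero, mul_neg, mul_one,
    Real.exp_neg 1] at h2
  rw [← hx] at h1
  rw [hVx, one_div (Real.exp 1)]
  have h3 : (1 - (Real.exp 1)⁻¹) * x ≤ 1 - (1 - 1 / B) ^ V := by linarith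
  calc _ = B * ((1 - (Real.exp 1)⁻¹) * x) := by ring
    _ ≤ _ := mul_le_mul_of_nonneg_left h3 hB0.le
end

section
/- The limit, as the positive integer k tends to infinity, of the ratio of binomial coefficients C(k² − k, k)/C(k², k) equals 1/e. Equivalently, 1 − C(k² − k, k)/C(k², k) tends to 1 − 1/e as k → ∞. -/
lemma ratio_eq_prod (k : ℕ) (hk : 2 ≤ k) :
    (((k ^ 2 - k).choose k : ℝ)) / (((k ^ 2).choose k : ℝ)) =
      ∏ i ∈ Finset.range k, (1 + -((k : ℝ) / ((k : ℝ) ^ 2 - i))) := by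
  have hf : ((k.factorial : ℕ) : ℝ) ≠ 0 := by exact_mod_cast k.factorial_ne_zero
  have h1 : (((k ^ 2 - k).choose k : ℝ)) / (((k ^ 2).choose k : ℝ)) =
      ((k ^ 2 - k).descFactorial k : ℝ) / ((k ^ 2).descFactorial k : ℝ) := by
    rw [Nat.descFactorial_eq_factorial_mul_choose, Nat.descFactorial_eq_factorial_mul_choose]
    push_cast
    rw [mul_div_mul_left _ _ hf]
  rw [h1, Nat.descFactorial_eq_prod_range, Nat.descFactorial_eq_prod_range]
  push_cast
  rw [← Finset.prod_div_distrib]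
  refine Finset.prod_congr rfl fun i hi => ?_
  have hi' : i < k := Finset.mem_range.1 hi
  have h2 : k ≤ k ^ 2 := by nlinarith
  have h3 : i ≤ k ^ 2 - k := by
    have : i + k ≤ k ^ 2 := by nlinarith
    omega
  have h4 : i ≤ k ^ 2 := by omega
  rw [Nat.cast_sub h3, Nat.cast_sub h2, Nat.cast_sub h4]
  have h5 : (i : ℝ) < (k : ℝ) ^ 2 := by
    have : i < k ^ 2 := by omega
    exact_mod_cast this
  have h6 : (k : ℝ) ^ 2 - i ≠ 0 := by linarith
  push_cast
  field_simp
  ring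

/-- As the positive integer `k` tends to infinity, the ratio of binomial coefficients
`C(k² - k, k)/C(k², k)` tends to `1/e`. -/
theorem choose_ratio_tendsto_inv_e :
    Filter.Tendsto
      (fun k : ℕ => (((k ^ 2 - k).choose k : ℝ)) / (((k ^ 2).choose k : ℝ)))
      Filter.atTop (nhds (1 / Real.exp 1)) := by
  have key : ∀ x : ℝ, Filter.Tendsto (fun k : ℕ => (1 + -(1 / ((k : ℝ) + x))) ^ k)
      Filter.atTop (nhds (1 / Real.exp 1)) := by
    intro x
    rw [one_div, ← Real.exp_neg]
    apply Real.tendsto_one_add_pow_exp_of_tendsto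
    have h := (tendsto_natCast_div_add_atTop (𝕜 := ℝ) x).neg
    refine h.congr fun k => ?_
    ring
  refine tendsto_of_tendsto_of_tendsto_of_le_of_le' (key (-1)) (key 0) ?_ ?_
  · filter_upwards [Filter.eventually_ge_atTop 2] with k hk
    rw [ratio_eq_prod k hk]
    have hk' : (2 : ℝ) ≤ k := by exact_mod_cast hk
    have : ((1 : ℝ) + -(1 / ((k : ℝ) + -1))) ^ k =
        ∏ i ∈ Finset.range k, ((1 : ℝ) + -(1 / ((k : ℝ) + -1))) := by simp
    rw [this]
    refine Finset.prod_le_prod (fun i _ => ?_) (fun i hi => ?_)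
    · have : 1 / ((k : ℝ) + -1) ≤ 1 := by
        rw [div_le_one (by linarith)]; linarith
      linarith
    · have hi' : (i : ℝ) < k := by exact_mod_cast Finset.mem_range.1 hi
      have : (k : ℝ) / ((k : ℝ) ^ 2 - i) ≤ 1 / ((k : ℝ) + -1) := by
        rw [div_le_div_iff₀ (by nlinarith) (by linarith)]
        nlinarith
      linarith
  · filter_upwards [Filter.eventually_ge_atTop 2] with k hk
    rw [ratio_eq_prod k hk]
    have hk' : (2 : ℝ) ≤ k := by exact_mod_cast hk
    have : ((1 : ℝ) + -(1 / ((k : ℝ) + 0))) ^ k =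
        ∏ i ∈ Finset.range k, ((1 : ℝ) + -(1 / ((k : ℝ) + 0))) := by simp
    rw [this]
    refine Finset.prod_le_prod (fun i hi => ?_) (fun i hi => ?_)
    · have hi' : (i : ℝ) < k := by exact_mod_cast Finset.mem_range.1 hi
      have : (k : ℝ) / ((k : ℝ) ^ 2 - i) ≤ 1 := by
        rw [div_le_one (by nlinarith)]; nlinarith
      linarith
    · have hi' : (i : ℝ) < k := by exact_mod_cast Finset.mem_range.1 hi
      have h0 : (0 : ℝ) ≤ i := Nat.cast_nonneg i
      have : 1 / ((k : ℝ) + 0) ≤ (k : ℝ) / ((k : ℝ) ^ 2 - i) := by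
        rw [div_le_div_iff₀ (by linarith) (by nlinarith)]
        nlinarith
      linarith
end

section
/- Let k ≥ 1 be an integer and n = k². For 0 ≤ j ≤ n define c_j = C(n, k) − C(n − j, k) (with the convention C(m, k) = 0 when m < k) and Δc_k = C(n − k − 1, k − 1). Then for every j with 1 ≤ j ≤ n, (j − k)·Δc_k + c_k ≥ c_j, where the left-hand side is computed in the integers (j − k may be negative). -/
theorem aux_up (p r d : ℕ) :
    (p+1).choose (r+1) + d * p.choose r ≤ (p+1+d).choose (r+1) := by
  induction d with
  | zero => simp
  | succ d ih =>
    have h := Nat.choose_succ_succ (p+1+d) r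
    have h2 : p.choose r ≤ (p+1+d).choose r := Nat.choose_le_choose r (by omega)
    have e : p + 1 + (d+1) = (p+1+d).succ := by omega
    rw [e, h, Nat.add_mul]
    simp only [Nat.succ_eq_add_one]
    omega

theorem aux_down (p r x d : ℕ) (h : x + d ≤ p + 1) :
    (x+d).choose (r+1) ≤ x.choose (r+1) + d * p.choose r := by
  induction d with
  | zero => simp
  | succ d ih =>
    have ih := ih (by omega)
    have h1 := Nat.choose_succ_succ (x+d) r
    have h2 : (x+d).choose r ≤ p.choose r := Nat.choose_le_choose r (by omega)
    have e : x + (d+1) = (x+d).succ := by omega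
    rw [e, h1, Nat.add_mul]
    simp only [Nat.succ_eq_add_one]
    omega


/-- Let `k ≥ 1`, `n = k²`, `c_j = C(n, k) - C(n - j, k)` and
`Δc_k = C(n - k - 1, k - 1)`.  Then for every `1 ≤ j ≤ n`,
`(j - k)·Δc_k + c_k ≥ c_j` (computed in the integers). -/
theorem dual_coefficient_bound (k n : ℕ) (hk : 1 ≤ k) (hn : n = k ^ 2)
    (j : ℕ) (hj1 : 1 ≤ j) (hjn : j ≤ n) :
    ((n.choose k : ℤ) - ((n - j).choose k : ℤ)) ≤
      ((j : ℤ) - (k : ℤ)) * (((n - k - 1).choose (k - 1) : ℤ)) +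
        ((n.choose k : ℤ) - ((n - k).choose k : ℤ)) := by
  obtain ⟨r, rfl⟩ : ∃ r, k = r + 1 := ⟨k - 1, by omega⟩
  rcases Nat.eq_zero_or_pos r with h0 | h0
  · subst h0
    have h1 : n = 1 := by simpa using hn
    have h2 : j = 1 := by omega
    subst h1 h2
    simp
  · obtain ⟨p, hp⟩ : ∃ p, n = (r + 1) + (p + 1) := ⟨n - (r+1) - 1, by
      have : n = r * r + 2 * r + 1 := by rw [hn]; ring
      have : 0 < r * r := Nat.mul_pos h0 h0
      omega⟩
    have e1 : n - (r+1) - 1 = p := by omega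
    have e2 : n - (r+1) = p + 1 := by omega
    have e3 : r + 1 - 1 = r := by omega
    rw [e1, e2, e3]
    rcases le_total j (r+1) with h | h
    · obtain ⟨d, hd⟩ := Nat.exists_eq_add_of_le h
      have e4 : n - j = p + 1 + d := by omega
      have := aux_up p r d
      rw [e4, hd]
      rw [hd] at *
      zify at this
      push_cast
      linarith
    · obtain ⟨d, hd⟩ := Nat.exists_eq_add_of_le h
      have e4 : (n - j) + d = p + 1 := by omega
      have := aux_down p r (n-j) d (by omega)
      rw [e4] at this
      have hj : (j:ℤ) - ((r+1 : ℕ):ℤ) = d := by rw [hd]; push_cast; ring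
      rw [hj]
      have t : ((p+1).choose (r+1) : ℤ) ≤ ((n-j).choose (r+1) : ℤ) + d * (p.choose r : ℤ) := by
        exact_mod_cast this
      linarith
end
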